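/- Let N be a positive natural number and L : Fin N → ℝ. Then the supremum over all parameter vectors φ : Fin N → ℝ of the softmax-weighted objective ∑ i, (Real.exp (φ i) / ∑ j, Real.exp (φ j)) * L i equals max over i of L i. -/

import Mathlib

open Filter Topology in
/-- Sending all logits except the `k`-th to `-∞` concentrates the softmax weights on `k`. -/
theorem tendsto_softmax_sum_atTop {ι : Type*} [Fintype ι] [DecidableEq ι] (L : ι → ℝ) (k : ι) :
    Tendsto (fun t : ℝ => ∑ i, (Real.exp (if i = k then 0 else -t) /
      ∑ j, Real.exp (if j = k then 0 else -t)) * L i) atTop (𝓝 (L k)) := by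
  have hexp (i : ι) : Tendsto (fun t : ℝ => Real.exp (if i = k then 0 else -t)) atTop
      (𝓝 (if i = k then 1 else 0)) := by
    by_cases h : i = k
    · simp [h]
    · simpa [h] using Real.tendsto_exp_neg_atTop_nhds_zero
  have hsum : Tendsto (fun t : ℝ => ∑ j, Real.exp (if j = k then 0 else -t)) atTop (𝓝 1) := by
    simpa using tendsto_finsetSum Finset.univ fun i _ => hexp i
  simpa using tendsto_finsetSum Finset.univ fun i _ =>
    ((hexp i).div hsum one_ne_zero).mul_const (L i)

/-- A softmax-weighted average is at most any upper bound of the averaged values. -/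
theorem softmax_sum_le {ι : Type*} [Fintype ι] [Nonempty ι] {L : ι → ℝ} {M : ℝ}
    (hL : ∀ i, L i ≤ M) (φ : ι → ℝ) :
    ∑ i, (Real.exp (φ i) / ∑ j, Real.exp (φ j)) * L i ≤ M := by
  have hpos : 0 < ∑ j, Real.exp (φ j) :=
    Finset.sum_pos (fun j _ => Real.exp_pos _) Finset.univ_nonempty
  calc ∑ i, (Real.exp (φ i) / ∑ j, Real.exp (φ j)) * L i
      ≤ ∑ i, (Real.exp (φ i) / ∑ j, Real.exp (φ j)) * M := by
        gcongr with i
        exact hL i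
    _ = M := by rw [← Finset.sum_mul, ← Finset.sum_div, div_self hpos.ne', one_mul]

/-- The supremum of the softmax-weighted objective over all parameter vectors
`φ` equals the maximal entry of `L`. -/
theorem softmax_sup_eq_max (N : ℕ) (hN : 0 < N) (L : Fin N → ℝ) :
    (⨆ φ : Fin N → ℝ, ∑ i, (Real.exp (φ i) / ∑ j, Real.exp (φ j)) * L i)
      = Finset.univ.sup' ⟨⟨0, hN⟩, Finset.mem_univ _⟩ L := by
  have : Nonempty (Fin N) := ⟨⟨0, hN⟩⟩
  have hle := softmax_sum_le (M := Finset.univ.sup' ⟨⟨0, hN⟩, Finset.mem_univ _⟩ L)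
    fun i => Finset.le_sup' L (Finset.mem_univ i)
  refine le_antisymm (ciSup_le hle) (Finset.sup'_le _ _ fun k _ => ?_)
  exact le_of_tendsto' (tendsto_softmax_sum_atTop L k) fun t =>
    le_ciSup (f := fun φ : Fin N → ℝ => ∑ i, (Real.exp (φ i) / ∑ j, Real.exp (φ j)) * L i)
      ⟨_, Set.forall_mem_range.2 hle⟩ fun i => if i = k then 0 else -t
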